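/- arXiv:1910.08228 — 3 statements merged into one kernel-verified Lean document; each statement's English description precedes it below -/
import Mathlib

section
/- Let k be a field and let g = ∑_{i=0}^n c_i X^i ∈ k[[t]][X] be a monic irreducible polynomial of degree n ≥ 1. Then for every j with 0 ≤ j ≤ n, one has n · ord_t(c_j) ≥ (n − j) · ord_t(c_0), as an inequality in ℕ ∪ {∞}. -/
open Polynomial in
/-- The Newton polygon of a monic irreducible polynomial over a complete nonarchimedean field has
a single slope. -/
theorem norm_coeff_pow_le_of_monic_irreducible {K : Type*} [NontriviallyNormedField K]
    [IsUltrametricDist K] [CompleteSpace K] {p : K[X]} (hp : p.Monic) (hirr : Irreducible p)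
    {j : ℕ} (hj : j ≤ p.natDegree) :
    ‖p.coeff j‖ ^ p.natDegree ≤ ‖p.coeff 0‖ ^ (p.natDegree - j) := by
  obtain rfl | hlt := hj.eq_or_lt
  · simp [hp]
  have : Fact (Irreducible p) := ⟨hirr⟩
  have : FiniteDimensional K (AdjoinRoot p) := (AdjoinRoot.powerBasis hirr.ne_zero).finite
  have hmin : minpoly K (AdjoinRoot.root p) = p := by
    simp [AdjoinRoot.minpoly_root hirr.ne_zero, hp]
  have hspec := spectralNorm.spectralNorm_eq_norm_coeff_zero_rpow K (AdjoinRoot p)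
    (AdjoinRoot.root p)
  rw [spectralNorm, hmin] at hspec
  have hle : spectralValueTerms p j ≤ spectralValue p :=
    le_ciSup (spectralValueTerms_bddAbove p) j
  rw [hspec, spectralValueTerms_of_lt_natDegree p hlt, ← Nat.cast_sub hj] at hle
  have hsub : p.natDegree - j ≠ 0 := by omega
  have hpow := pow_le_pow_left₀ (by positivity) hle (p.natDegree * (p.natDegree - j))
  rwa [one_div, one_div, mul_comm, pow_mul, Real.rpow_inv_natCast_pow (norm_nonneg _) hsub,
    mul_comm, pow_mul, Real.rpow_inv_natCast_pow (norm_nonneg _) (by omega)] at hpow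

open LaurentSeries in
theorem PowerSeries.order_le_order_of_valuation_coe_le {k : Type*} [Field k] {f g : PowerSeries k}
    (h : Valued.v (g : k⸨X⸩) ≤ Valued.v (f : k⸨X⸩)) : f.order ≤ g.order := by
  refine ENat.forall_natCast_le_iff_le.mp fun d hd ↦ PowerSeries.nat_le_order _ _ ?_
  rw [← intValuation_le_iff_coeff_lt_eq_zero]
  exact h.trans ((intValuation_le_iff_coeff_lt_eq_zero k f).mpr fun i hi ↦
    PowerSeries.coeff_of_lt_order i ((Nat.cast_lt.mpr hi).trans_le hd))

open LaurentSeries in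
theorem LaurentSeries.nonempty_rankOne (k : Type*) [Field k] :
    Nonempty (Valued.v : Valuation k⸨X⸩ (WithZero (Multiplicative ℤ))).RankOne := by
  have : (Valued.v : Valuation k⸨X⸩ (WithZero (Multiplicative ℤ))).IsNontrivial := by
    refine ⟨HahnSeries.single 1 1, ?_, ?_⟩
    · simp
    · rw [show Valued.v (HahnSeries.single 1 1 : k⸨X⸩) = _ from valuation_single_zpow k 1,
        ← WithZero.exp_zero, Ne, WithZero.exp_inj]
      decide
  rw [Valuation.nonempty_rankOne_iff_mulArchimedean]
  infer_instance

/-- Newton polygon bound: if `g ∈ k[[t]][X]` is monic irreducible of degree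
`n ≥ 1`, then `n · ord_t(c_j) ≥ (n − j) · ord_t(c_0)` for every `0 ≤ j ≤ n`, as an inequality
in `ℕ∞`. -/
theorem stmt_5 {k : Type*} [Field k] (n : ℕ) (hn : 1 ≤ n)
    (g : Polynomial (PowerSeries k)) (hmon : g.Monic) (hirr : Irreducible g)
    (hdeg : g.natDegree = n) :
    ∀ j ≤ n, ((n - j : ℕ) : ℕ∞) * (g.coeff 0).order ≤ (n : ℕ∞) * (g.coeff j).order := by
  intro j hj
  subst hdeg
  obtain ⟨_⟩ := LaurentSeries.nonempty_rankOne k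
  let : NontriviallyNormedField (LaurentSeries k) :=
    Valued.toNontriviallyNormedField (LaurentSeries k) (WithZero (Multiplicative ℤ))
  have h := norm_coeff_pow_le_of_monic_irreducible
    (hmon.map (algebraMap (PowerSeries k) (LaurentSeries k)))
    ((hmon.irreducible_iff_irreducible_map_fraction_map (K := LaurentSeries k)).mp hirr)
    (j := j) (by rwa [hmon.natDegree_map])
  rw [hmon.natDegree_map, ← norm_pow, ← norm_pow, Valued.toNormedField.norm_le_iff,
    Polynomial.coeff_map, Polynomial.coeff_map, ← map_pow, ← map_pow] at h
  simpa [PowerSeries.order_pow] using PowerSeries.order_le_order_of_valuation_coe_le h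
end

section
/- Let k be a field and let g = ∑_{i=0}^n c_i X^i ∈ k[[t]][X] be a monic irreducible polynomial of degree n ≥ 1 with c_0 ≠ 0, such that t divides c_i for every i < n. Set λ := ord_t(c_0) ∈ ℕ and let M be the ideal of k[[t]][X] generated by X and t. Then g ∈ M^{min(n, λ)} and g ∉ M^{min(n, λ)+1}. -/
open Polynomial in
/-- Over a complete local ring, a polynomial whose constant coefficient lies in the maximal ideal
but whose `i`-th coefficient does not has a monic factor of degree between `1` and `i`. -/
theorem Polynomial.exists_monic_dvd_of_coeff_notMem_maximalIdeal {A : Type*} [CommRing A]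
    [IsLocalRing A] [IsAdicComplete (IsLocalRing.maximalIdeal A) A] {h : A[X]} {i : ℕ}
    (h0 : h.coeff 0 ∈ IsLocalRing.maximalIdeal A) (hi : h.coeff i ∉ IsLocalRing.maximalIdeal A) :
    ∃ f : A[X], f.Monic ∧ 0 < f.natDegree ∧ f.natDegree ≤ i ∧ f ∣ h := by
  have hcoeff : PowerSeries.coeff i ((h : PowerSeries A).map (IsLocalRing.residue A)) ≠ 0 := by
    simpa [IsLocalRing.residue_eq_zero_iff] using hi
  have hne : (h : PowerSeries A).map (IsLocalRing.residue A) ≠ 0 := by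
    intro h'
    simp [h'] at hcoeff
  obtain ⟨f, u, H⟩ := PowerSeries.exists_isWeierstrassFactorization hne
  have htop : IsLocalRing.maximalIdeal A ≠ ⊤ := Ideal.IsPrime.ne_top'
  refine ⟨f, H.isDistinguishedAt.monic, ?_, ?_, ?_⟩
  · rw [Nat.pos_iff_ne_zero]
    intro hd
    have hf : f = 1 := H.isDistinguishedAt.monic.natDegree_eq_zero.mp hd
    have hu := PowerSeries.isUnit_iff_constantCoeff.mp H.isUnit
    have heq : h.coeff 0 = PowerSeries.constantCoeff u := by
      rw [← Polynomial.coeff_coe, H.eq_mul, hf]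
      simp
    exact (IsLocalRing.mem_maximalIdeal _).mp h0 (heq ▸ hu)
  · rw [H.natDegree_eq_toNat_order_map_of_ne_top htop]
    exact ENat.toNat_le_of_le_natCast (PowerSeries.order_le i hcoeff)
  · rw [← Ideal.mem_span_singleton, ← Ideal.Quotient.eq_zero_iff_mem]
    apply H.isDistinguishedAt.algEquivQuotient.injective
    rw [map_zero, Polynomial.IsDistinguishedAt.algEquivQuotient_apply]
    refine Ideal.Quotient.eq_zero_iff_mem.mpr ?_
    rw [Ideal.mem_span_singleton]
    exact ⟨u, by simpa using H.eq_mul⟩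

open Polynomial in
/-- A monic polynomial over a domain which divides a multiple of `g` by a power of a prime constant
divides `g`. -/
theorem Polynomial.Monic.dvd_of_dvd_C_pow_mul {A : Type*} [CommRing A] [IsDomain A] {p : A}
    (hp : Prime p) {f g : A[X]} (hf : f.Monic) {s : ℕ} (h : f ∣ C p ^ s * g) : f ∣ g := by
  have hpC : Prime (C p) := prime_C_iff.mpr hp
  obtain ⟨q, hq⟩ := h
  have hpf : ¬ C p ∣ f := fun hdvd ↦ hp.not_isUnit <| isUnit_of_dvd_one <| by
    simpa [hf.coeff_natDegree] using (C_dvd_iff_dvd_coeff p f).mp hdvd f.natDegree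
  obtain ⟨q', rfl⟩ := hpC.pow_dvd_of_dvd_mul_left s hpf ⟨g, hq.symm⟩
  exact ⟨q', mul_left_cancel₀ (pow_ne_zero s hpC.ne_zero) (by rw [hq]; ring)⟩

open Polynomial in
/-- Let `g` be a monic irreducible polynomial over a complete discrete valuation ring with
uniformizer `p`. If the line of slope `-1` through `(0, N)` with `N < deg g` lies on or below the
Newton polygon of `g`, and strictly below it at `0`, then it lies strictly below it everywhere. -/
theorem Irreducible.pow_succ_sub_dvd_coeff {A : Type*} [CommRing A] [IsDomain A] [IsLocalRing A]
    [IsAdicComplete (IsLocalRing.maximalIdeal A) A] {p : A} (hp : Prime p)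
    (hmax : IsLocalRing.maximalIdeal A = Ideal.span {p}) {g : A[X]} (hirr : Irreducible g)
    (hmon : g.Monic) {N : ℕ} (hN : N < g.natDegree) (h0 : p ^ (N + 1) ∣ g.coeff 0)
    (hdvd : ∀ i, p ^ (N - i) ∣ g.coeff i) (i : ℕ) : p ^ (N + 1 - i) ∣ g.coeff i := by
  by_contra hi
  have hiN : i ≤ N := by
    by_contra hlt
    exact hi (by simp [show N + 1 - i = 0 by omega])
  have hpN : p ^ N ≠ 0 := pow_ne_zero N hp.ne_zero
  have hex (j : ℕ) : ∃ e, g.coeff j * p ^ j = p ^ N * e := by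
    obtain ⟨c, hc⟩ := hdvd j
    refine (pow_dvd_pow p (show N ≤ N - j + j by omega)).trans ?_
    rw [hc, pow_add]
    exact ⟨c, by ring⟩
  choose e he using hex
  have he_zero (j : ℕ) (hj : g.natDegree < j) : e j = 0 := by
    have := he j
    rw [coeff_eq_zero_of_natDegree_lt hj, zero_mul] at this
    exact (mul_eq_zero.mp this.symm).resolve_left hpN
  let h : A[X] := ∑ j ∈ Finset.range (g.natDegree + 1), monomial j (e j)
  have hcoeff (j : ℕ) : h.coeff j = e j := by
    simp only [h, finsetSum_coeff, coeff_monomial, Finset.sum_ite_eq', Finset.mem_range]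
    split_ifs with hj
    · rfl
    · exact (he_zero j (by omega)).symm
  have hdeg : h.natDegree = g.natDegree := by
    refine natDegree_eq_of_le_of_coeff_ne_zero ?_ ?_
    · exact natDegree_le_iff_coeff_eq_zero.mpr fun j hj ↦ by rw [hcoeff, he_zero j hj]
    · intro hzero
      have := he g.natDegree
      rw [← hcoeff, hzero, hmon.coeff_natDegree, one_mul, mul_zero] at this
      exact pow_ne_zero _ hp.ne_zero this
  have hscale : h.scaleRoots p = C p ^ (g.natDegree - N) * g := by
    ext j
    rw [coeff_scaleRoots, hcoeff, hdeg, ← C_pow, coeff_C_mul]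
    rcases lt_or_ge g.natDegree j with hj | hj
    · rw [he_zero j hj, coeff_eq_zero_of_natDegree_lt hj, zero_mul, mul_zero]
    · refine mul_left_cancel₀ hpN ?_
      rw [← mul_assoc, ← he, mul_assoc, ← pow_add, ← mul_assoc, ← pow_add,
        show j + (g.natDegree - j) = N + (g.natDegree - N) by omega, mul_comm]
  obtain ⟨f, hf, hfpos, hfi, hfh⟩ :=
    exists_monic_dvd_of_coeff_notMem_maximalIdeal (h := h) (i := i)
      (by
        rw [hmax, Ideal.mem_span_singleton, hcoeff]
        refine (mul_dvd_mul_iff_left hpN).mp ?_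
        rw [← he, ← pow_succ, pow_zero, mul_one]
        exact h0)
      (by
        rw [hmax, Ideal.mem_span_singleton, hcoeff]
        intro hpe
        refine hi ((mul_dvd_mul_iff_right (pow_ne_zero i hp.ne_zero)).mp ?_)
        rw [he, ← pow_add, show N + 1 - i + i = N + 1 by omega, pow_succ]
        exact mul_dvd_mul_left _ hpe)
  have hF : (f.scaleRoots p).Monic := (monic_scaleRoots_iff p).mpr hf
  obtain ⟨q, hq⟩ : f.scaleRoots p ∣ g :=
    hF.dvd_of_dvd_C_pow_mul hp (hscale ▸ scaleRoots_dvd _ _ hfh)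
  have hq_mon : q.Monic := hF.of_mul_monic_left (hq ▸ hmon)
  have hdegs : g.natDegree = f.natDegree + q.natDegree := by
    rw [hq, hF.natDegree_mul hq_mon, natDegree_scaleRoots]
  rcases hirr.isUnit_or_isUnit hq with hu | hu
  · have := natDegree_eq_zero_of_isUnit hu
    rw [natDegree_scaleRoots] at this
    omega
  · have := natDegree_eq_zero_of_isUnit hu
    omega

open Polynomial in
/-- Membership in the powers of the ideal `(X, p)` of a polynomial ring, in terms of
coefficients. -/
theorem Polynomial.mem_span_X_C_pow_iff {A : Type*} [CommRing A] {p : A} {f : A[X]} {N : ℕ} :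
    f ∈ Ideal.span {X, C p} ^ N ↔ ∀ i, p ^ (N - i) ∣ f.coeff i := by
  constructor
  · induction N generalizing f with
    | zero => simp
    | succ N ih =>
      intro hf i
      rw [pow_succ] at hf
      refine Submodule.mul_induction_on hf (fun a ha b hb ↦ ?_) fun a b ha hb ↦ ?_
      · obtain ⟨c, d, rfl⟩ := Ideal.mem_span_pair.mp hb
        rw [mul_add, ← mul_assoc, ← mul_assoc, coeff_add, coeff_mul_C]
        refine dvd_add ?_ ?_
        · cases i with
          | zero => simp
          | succ i =>
            rw [coeff_mul_X, Nat.add_sub_add_right]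
            exact ih (Ideal.mul_mem_right c _ ha) i
        · refine (pow_dvd_pow p (show N + 1 - i ≤ N - i + 1 by omega)).trans ?_
          rw [pow_succ]
          exact mul_dvd_mul_right (ih (Ideal.mul_mem_right d _ ha) i) p
      · rw [coeff_add]
        exact dvd_add ha hb
  · intro hf
    rw [f.as_sum_range_C_mul_X_pow]
    refine Ideal.sum_mem _ fun i _ ↦ ?_
    obtain ⟨c, hc⟩ := hf i
    have hX : (X : A[X]) ∈ Ideal.span {X, C p} := Ideal.subset_span (by simp)
    have hC : C p ∈ Ideal.span {X, C p} := Ideal.subset_span (by simp)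
    have hmem := Ideal.mul_mem_mul (Ideal.pow_mem_pow hC (N - i)) (Ideal.pow_mem_pow hX i)
    rw [← pow_add] at hmem
    rw [hc, C_mul, C_pow, mul_right_comm]
    exact Ideal.mul_mem_right _ _ (Ideal.pow_le_pow_right (by omega) hmem)

/-- Let `g ∈ k[[t]][X]` be monic irreducible of degree `n ≥ 1` with nonzero
constant coefficient, all of whose coefficients below the leading one are divisible by `t`.
If `λ` is the `t`-adic order of the constant coefficient and `M = (X, t)`, then
`g ∈ M^min(n,λ)` and `g ∉ M^(min(n,λ)+1)`. -/
theorem stmt_6 {k : Type*} [Field k] (n : ℕ) (hn : 1 ≤ n)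
    (g : Polynomial (PowerSeries k)) (hmon : g.Monic) (hirr : Irreducible g)
    (hdeg : g.natDegree = n) (h0 : g.coeff 0 ≠ 0)
    (hdiv : ∀ i < n, (PowerSeries.X : PowerSeries k) ∣ g.coeff i)
    (lam : ℕ) (hlam : (g.coeff 0).order = (lam : ℕ∞))
    (M : Ideal (Polynomial (PowerSeries k)))
    (hM : M = Ideal.span {Polynomial.X, Polynomial.C PowerSeries.X}) :
    g ∈ M ^ (min n lam) ∧ g ∉ M ^ (min n lam + 1) := by
  subst hM hdeg
  have hprime : Prime (PowerSeries.X : PowerSeries k) := PowerSeries.X_prime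
  have hmax := PowerSeries.maximalIdeal_eq_span_X (k := k)
  have : IsAdicComplete (IsLocalRing.maximalIdeal (PowerSeries k)) (PowerSeries k) := by
    rw [hmax]
    infer_instance
  have hc0 (m : ℕ) : PowerSeries.X ^ m ∣ g.coeff 0 ↔ m ≤ lam := by
    rw [PowerSeries.X_pow_dvd_iff, ← ENat.natCast_le_natCast, ← hlam]
    exact ⟨PowerSeries.nat_le_order _ _, fun h i hi ↦
      PowerSeries.coeff_of_lt_order _ (lt_of_lt_of_le (by exact_mod_cast hi) h)⟩
  rw [Polynomial.mem_span_X_C_pow_iff, Polynomial.mem_span_X_C_pow_iff]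
  constructor
  · suffices ∀ N ≤ min g.natDegree lam, ∀ i, PowerSeries.X ^ (N - i) ∣ g.coeff i from
      this _ le_rfl
    intro N
    induction N with
    | zero => simp
    | succ N ih =>
      intro hN
      exact hirr.pow_succ_sub_dvd_coeff hprime hmax hmon (by omega) ((hc0 _).mpr (by omega))
        (ih (by omega))
  · intro h
    rcases le_or_gt g.natDegree lam with hle | hlt
    · have := h g.natDegree
      rw [min_eq_left hle, Nat.add_sub_cancel_left, pow_one, hmon.coeff_natDegree] at this
      exact hprime.not_isUnit (isUnit_of_dvd_one this)
    · have := (hc0 _).mp (h 0)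
      omega
end

section
/- Let k be an algebraically closed field, let n ≥ 1 be an integer with char k = 0 or char k > n, let K := k((t)) be the field of formal Laurent series over k, and let g ∈ K[X] be an irreducible polynomial of degree n. Then the splitting field L of g over K satisfies: [L : K] = n, the extension L/K is Galois with cyclic Galois group, and there exists s ∈ L with s^n equal to the image of t in L and L = K(s). -/
open scoped TensorProduct in
/-- A finite Hausdorff module over an adically complete ring is adically complete. -/
theorem IsAdicComplete.of_finite {R : Type*} [CommRing R] (I : Ideal R) [IsAdicComplete I R]
    (M : Type*) [AddCommGroup M] [Module R M] [Module.Finite R M] [IsHausdorff I M] :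
    IsAdicComplete I M := by
  have hs : Function.Surjective (AdicCompletion.of I M) := by
    intro y
    obtain ⟨z, rfl⟩ := AdicCompletion.ofTensorProduct_surjective_of_finite I M y
    induction z using TensorProduct.induction_on with
    | zero => exact ⟨0, by simp⟩
    | tmul a x =>
      obtain ⟨r, rfl⟩ := AdicCompletion.of_surjective I R a
      refine ⟨r • x, ?_⟩
      rw [AdicCompletion.ofTensorProduct_tmul, map_smul]
      ext n
      simp
      rfl
    | add x y hx hy =>
      obtain ⟨u, hu⟩ := hx
      obtain ⟨v, hv⟩ := hy
      exact ⟨u + v, by rw [map_add, map_add, hu, hv]⟩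
  have := AdicCompletion.of_surjective_iff.mp hs
  exact { }

namespace HenselianRing

variable {B : Type*} [CommRing B] (I : Ideal B) [HenselianRing B I]

theorem isUnit_of_isUnit_mk {x : B} (hx : IsUnit (Ideal.Quotient.mk I x)) : IsUnit x :=
  (isLocalHom_of_le_jacobson_bot I HenselianRing.jac).map_nonunit x hx

open Polynomial in
theorem isIdempotentElem_quotient_eq [IsDomain B] {e : B ⧸ I} (he : IsIdempotentElem e) :
    e = 0 ∨ e = 1 := by
  obtain ⟨a, rfl⟩ := Ideal.Quotient.mk_surjective e
  have he' := he.eq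
  have hmonic : (X ^ 2 - X : B[X]).Monic := by monicity!
  obtain ⟨b, hb, hba⟩ := HenselianRing.is_henselian (I := I) (X ^ 2 - X) hmonic a
    (by
      rw [← Ideal.Quotient.eq_zero_iff_mem]
      simp [pow_two, he'])
    (by
      refine IsUnit.of_mul_eq_one (Ideal.Quotient.mk I (2 * a - 1)) ?_
      have h2 : Ideal.Quotient.mk I (2 : B) = 2 := map_ofNat _ 2
      simp only [map_sub, derivative_X_pow, derivative_X, eval_sub, eval_mul, eval_pow,
        eval_X, eval_one, map_mul, map_pow, map_one, eval_C, Nat.cast_ofNat, h2]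
      linear_combination 4 * he')
  rw [← Ideal.Quotient.mk_eq_mk_iff_sub_mem] at hba
  have h0 : b * (b - 1) = 0 := by
    have := hb.eq_zero
    simp at this
    linear_combination this
  rcases mul_eq_zero.mp h0 with h | h
  · left; rw [← hba, h, map_zero]
  · right; rw [← hba, sub_eq_zero.mp h, map_one]

theorem isNilpotent_or_isUnit [IsDomain B] [IsArtinianRing (B ⧸ I)] (x : B) :
    IsNilpotent (Ideal.Quotient.mk I x) ∨ IsUnit x := by
  obtain ⟨n, y, hy⟩ := IsArtinian.exists_pow_succ_smul_dvd (Ideal.Quotient.mk I x) (1 : B ⧸ I)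
  set r := Ideal.Quotient.mk I x
  replace hy : r ^ n * (r * y) = r ^ n := by
    simpa [pow_succ, mul_assoc] using hy
  have hj (j : ℕ) : r ^ n * (r * y) ^ j = r ^ n := by
    induction j with
    | zero => simp
    | succ j ih => rw [pow_succ, ← mul_assoc, ih, hy]
  have he : IsIdempotentElem ((r * y) ^ n) := by
    change _ * _ = _
    conv_lhs => enter [1]; rw [mul_pow]
    rw [mul_right_comm, hj, mul_pow]
  rcases isIdempotentElem_quotient_eq I he with h | h
  · left
    exact ⟨n, by rw [← hj n, h, mul_zero]⟩
  · right
    apply isUnit_of_isUnit_mk I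
    rcases Nat.eq_zero_or_pos n with rfl | hn
    · exact IsUnit.of_mul_eq_one y (by simpa using hy)
    · exact isUnit_of_mul_isUnit_left ((isUnit_pow_iff hn.ne').mp (h ▸ isUnit_one))

theorem isLocalRing [IsDomain B] [IsArtinianRing (B ⧸ I)] : IsLocalRing B := by
  refine IsLocalRing.of_isUnit_or_isUnit_one_sub_self fun x ↦ ?_
  rcases isNilpotent_or_isUnit I x with h | h
  · right
    apply isUnit_of_isUnit_mk I
    rw [map_sub, map_one]
    exact h.isUnit_one_sub
  · exact Or.inl h

open Polynomial in
/-- In a Henselian pair, a unit which is an `n`-th power up to an element nilpotent modulo `I`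
is an `n`-th power, provided `n` is invertible. -/
theorem exists_pow_eq {n : ℕ} (hn : IsUnit (n : B)) {w d : B} (hd : IsUnit d)
    (h : IsNilpotent (Ideal.Quotient.mk I (d ^ n - w))) : ∃ a, a ^ n = w := by
  rcases subsingleton_or_nontrivial B with hB | hB
  · exact ⟨0, Subsingleton.elim _ _⟩
  have hn0 : n ≠ 0 := by rintro rfl; simp at hn
  have hder (x : B) : (X ^ n - C w : B[X]).derivative.eval x = n * x ^ (n - 1) := by
    simp [derivative_X_pow]
  obtain ⟨r, ⟨hr, hr'⟩, -⟩ := existsUnique_nilpotent_sub_and_aeval_eq_zero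
    (P := (X ^ n - C w : B[X])) (x := Ideal.Quotient.mk I d) (by simpa using h)
    (by
      have := (hn.mul (hd.pow (n - 1))).map (Ideal.Quotient.mk I)
      simpa [derivative_X_pow] using this)
  obtain ⟨b, rfl⟩ := Ideal.Quotient.mk_surjective r
  have hb : IsUnit (Ideal.Quotient.mk I b) := by
    have := hr.neg.isUnit_add_left_of_commute (hd.map (Ideal.Quotient.mk I)) (Commute.all _ _)
    simpa using this
  obtain ⟨a, ha, -⟩ := HenselianRing.is_henselian (I := I) (X ^ n - C w)
    (monic_X_pow_sub_C w hn0) b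
    (by
      rw [← Ideal.Quotient.eq_zero_iff_mem]
      simpa using hr')
    (by
      rw [hder, map_mul, map_pow]
      exact (hn.map _).mul (hb.pow _))
  exact ⟨a, by simpa [sub_eq_zero] using ha⟩

end HenselianRing

namespace PowerSeries

variable {k : Type*} [Field k] [IsAlgClosed k] {B : Type*} [CommRing B] [Algebra k⟦X⟧ B]

/-- Over an algebraically closed field `k`, a local ring integral over `k⟦X⟧` has
residue field `k`. -/
theorem exists_sub_algebraMap_C_mem_maximalIdeal [IsLocalRing B]
    [Algebra.IsIntegral k⟦X⟧ B] [FaithfulSMul k⟦X⟧ B] (b : B) :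
    ∃ c : k, b - algebraMap k⟦X⟧ B (C c) ∈ IsLocalRing.maximalIdeal B := by
  let φ : k⟦X⟧ →+* IsLocalRing.ResidueField B := (IsLocalRing.residue B).comp (algebraMap k⟦X⟧ B)
  have hX : φ X = 0 := by
    rw [RingHom.comp_apply, IsLocalRing.residue_eq_zero_iff, IsLocalRing.mem_maximalIdeal]
    exact fun h ↦ X_prime.not_isUnit (isUnit_of_map_unit _ _ h)
  have hφ : φ = (φ.comp C).comp constantCoeff := by
    refine RingHom.ext fun f ↦ ?_
    obtain ⟨g, hg⟩ : X ∣ f - C (constantCoeff f) := X_dvd_iff.mpr (by simp)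
    have := congrArg φ hg
    rw [map_mul, hX, zero_mul, map_sub, sub_eq_zero] at this
    simpa using this
  have hint : (φ.comp C).IsIntegral := by
    intro z
    obtain ⟨b, rfl⟩ := IsLocalRing.residue_surjective z
    obtain ⟨p, hp, hpb⟩ := Algebra.IsIntegral.isIntegral (R := k⟦X⟧) b
    refine ⟨p.map constantCoeff, hp.map _, ?_⟩
    rw [Polynomial.eval₂_map, ← hφ, ← Polynomial.hom_eval₂, hpb, map_zero]
  obtain ⟨c, hc⟩ := (IsAlgClosed.ringHom_bijective_of_isIntegral _ hint).2 (IsLocalRing.residue B b)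
  refine ⟨c, ?_⟩
  rw [← IsLocalRing.residue_eq_zero_iff, map_sub, ← hc, sub_eq_zero]
  rfl

open IsLocalRing in
theorem inertiaDeg_maximalIdeal_eq_one [IsLocalRing B]
    [Algebra.IsIntegral k⟦X⟧ B] [FaithfulSMul k⟦X⟧ B] :
    (maximalIdeal B).inertiaDeg k⟦X⟧ = 1 := by
  have : (maximalIdeal B).LiesOver (maximalIdeal k⟦X⟧) :=
    ⟨.symm <| ((local_hom_TFAE (algebraMap k⟦X⟧ B)).out 4 0).mpr (inferInstance : IsLocalHom _)⟩
  rw [Ideal.inertiaDeg_eq_of_isMaximal (maximalIdeal k⟦X⟧) (maximalIdeal B)]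
  let := Ideal.Quotient.field (maximalIdeal k⟦X⟧)
  refine (finrank_eq_one_iff_of_nonzero' (1 : B ⧸ maximalIdeal B) one_ne_zero).mpr fun w ↦ ?_
  obtain ⟨b, rfl⟩ := Ideal.Quotient.mk_surjective w
  obtain ⟨c, hc⟩ := exists_sub_algebraMap_C_mem_maximalIdeal (k := k) b
  refine ⟨Ideal.Quotient.mk _ (C c), ?_⟩
  rw [← Ideal.Quotient.mk_eq_mk_iff_sub_mem] at hc
  rw [hc, Algebra.smul_def, mul_one]
  rfl

open IsLocalRing in
/-- In a local Dedekind domain of rank `n` over `k⟦X⟧`, with `k` algebraically closed,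
the extension is totally ramified. -/
theorem map_span_X_eq_maximalIdeal_pow [IsLocalRing B] [IsDedekindDomain B]
    [Module.Finite k⟦X⟧ B] [FaithfulSMul k⟦X⟧ B] :
    (Ideal.span {(X : k⟦X⟧)}).map (algebraMap k⟦X⟧ B) =
      maximalIdeal B ^ Module.finrank k⟦X⟧ B := by
  rw [← maximalIdeal_eq_span_X]
  set p := maximalIdeal k⟦X⟧
  have hp0 : p ≠ ⊥ := IsDiscreteValuationRing.not_a_field _
  have hover : p.primesOver B = {maximalIdeal B} := primesOver_eq B hp0
  have hlies : (maximalIdeal B).LiesOver p :=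
    ⟨.symm <| ((local_hom_TFAE (algebraMap k⟦X⟧ B)).out 4 0).mpr (inferInstance : IsLocalHom _)⟩
  have : Module.IsTorsionFree k⟦X⟧ B := inferInstance
  have hpB : p.map (algebraMap k⟦X⟧ B) ≠ ⊥ := Ideal.map_ne_bot_of_ne_bot hp0
  have hnf : ¬ IsField B := by
    rw [isField_iff_maximalIdeal_eq]
    intro h
    exact hpB (le_bot_iff.mp (h ▸
      ((local_hom_TFAE (algebraMap k⟦X⟧ B)).out 2 0).mpr (inferInstance : IsLocalHom _)))
  have hpow : ∀ (I : Ideal B) (_ : I ≠ ⊥), ∃ n : ℕ, I = maximalIdeal B ^ n :=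
    ((IsDiscreteValuationRing.TFAE B hnf).out 6 2).mpr (inferInstance : IsDedekindDomain B)
  obtain ⟨e, he⟩ := hpow _ hpB
  let : Unique (p.primesOver B) := by rw [hover]; infer_instance
  have hsum := p.sum_ramification_inertia_eq_finrank B
  have hdef : ((default : p.primesOver B) : Ideal B) = maximalIdeal B :=
    Set.mem_singleton_iff.mp (hover.le (default : p.primesOver B).2)
  rw [Fintype.sum_unique, hdef, inertiaDeg_maximalIdeal_eq_one, mul_one,
    Ideal.IsDedekindDomain.ramificationIdx_eq_multiplicity p _ hpB, he,
    multiplicity_pow_self (fun h ↦ hnf (isField_iff_maximalIdeal_eq.mpr h))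
      (by rw [Ideal.isUnit_iff]; exact Ideal.IsPrime.ne_top')] at hsum
  rw [he, hsum]

open IsLocalRing in
/-- A Dedekind domain of finite rank `n` over `k⟦X⟧`, with `k` algebraically closed and `n`
invertible in `k`, contains an `n`-th root of `X`. -/
theorem exists_pow_finrank_eq_X [IsDedekindDomain B]
    [Module.Finite k⟦X⟧ B] [FaithfulSMul k⟦X⟧ B] (hn : (Module.finrank k⟦X⟧ B : k) ≠ 0) :
    ∃ s : B, s ^ Module.finrank k⟦X⟧ B = algebraMap k⟦X⟧ B X := by
  set n := Module.finrank k⟦X⟧ B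
  have hn0 : n ≠ 0 := by rintro h; simp [h] at hn
  set p : Ideal k⟦X⟧ := Ideal.span {X} with hp
  set I : Ideal B := p.map (algebraMap k⟦X⟧ B) with hI
  have hpm : p.IsMaximal := hp ▸ maximalIdeal_eq_span_X (k := k) ▸ maximalIdeal.isMaximal k⟦X⟧
  have : IsHausdorff p B := .of_isLocalRing p B hpm.ne_top
  have : IsAdicComplete p B := .of_finite p B
  have : IsAdicComplete I B := (IsAdicComplete.map_algebraMap_iff p B).mpr this
  have : IsArtinianRing (B ⧸ I) := by
    let := Ideal.Quotient.field p
    exact isArtinian_of_tower (k⟦X⟧ ⧸ p) inferInstance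
  have : IsLocalRing B := HenselianRing.isLocalRing I
  have hIm : I = maximalIdeal B ^ n := map_span_X_eq_maximalIdeal_pow
  have hXI : I = Ideal.span {algebraMap k⟦X⟧ B X} := by
    rw [hI, hp, Ideal.map_span, Set.image_singleton]
  have hX0 : algebraMap k⟦X⟧ B X ≠ 0 := by
    rw [Ne, FaithfulSMul.algebraMap_eq_zero_iff]; exact X_ne_zero
  have hnf : ¬ IsField B := by
    rw [isField_iff_maximalIdeal_eq]
    intro h
    rw [hIm, h, ← Ideal.zero_eq_bot, zero_pow hn0, eq_comm, Ideal.zero_eq_bot,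
      Ideal.span_singleton_eq_bot] at hXI
    exact hX0 hXI
  have : (maximalIdeal B).IsPrincipal := 
    ((IsDiscreteValuationRing.TFAE B hnf).out 4 2).mpr (inferInstance : IsDedekindDomain B)
  obtain ⟨π, hπ⟩ := this.principal
  rw [Ideal.submodule_span_eq] at hπ
  rw [hIm, hπ, Ideal.span_singleton_pow, Ideal.span_singleton_eq_span_singleton] at hXI
  obtain ⟨w, hw⟩ := hXI
  obtain ⟨c, hc⟩ := exists_sub_algebraMap_C_mem_maximalIdeal (k := k) (w : B)
  obtain ⟨d, rfl⟩ := IsAlgClosed.exists_pow_nat_eq c (Nat.pos_of_ne_zero hn0)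
  have hd : d ≠ 0 := by
    rintro rfl
    rw [zero_pow hn0, map_zero, map_zero, sub_zero] at hc
    exact hc w.isUnit
  obtain ⟨a, ha⟩ := HenselianRing.exists_pow_eq I (n := n) (w := (w : B))
    (d := algebraMap k⟦X⟧ B (C d))
    (by simpa using ((IsUnit.mk0 _ hn).map C).map (algebraMap k⟦X⟧ B))
    (((IsUnit.mk0 _ hd).map C).map (algebraMap k⟦X⟧ B))
    ((HenselianRing.isNilpotent_or_isUnit I _).resolve_right (by
      rw [← neg_sub, IsUnit.neg_iff, ← map_pow, ← map_pow]
      exact hc))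
  exact ⟨π * a, by rw [mul_pow, ha, hw]⟩

end PowerSeries

namespace LaurentSeries

open PowerSeries Polynomial IntermediateField

variable {k : Type*} [Field k] {E : Type*} [Field E] [Algebra k⸨X⸩ E]

theorem exists_pow_finrank_eq_X [IsAlgClosed k] [FiniteDimensional k⸨X⸩ E]
    [Algebra.IsSeparable k⸨X⸩ E] (hn : (Module.finrank k⸨X⸩ E : k) ≠ 0) :
    ∃ s : E, s ^ Module.finrank k⸨X⸩ E =
      algebraMap k⸨X⸩ E ((PowerSeries.X : k⟦X⟧) : k⸨X⸩) := by
  let : Algebra k⟦X⟧ E := ((algebraMap k⸨X⸩ E).comp (algebraMap k⟦X⟧ k⸨X⸩)).toAlgebra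
  have : IsScalarTower k⟦X⟧ k⸨X⸩ E := .of_algebraMap_eq fun _ ↦ rfl
  let B := integralClosure k⟦X⟧ E
  have : IsDedekindDomain B := IsIntegralClosure.isDedekindDomain k⟦X⟧ k⸨X⸩ E B
  have : Module.Finite k⟦X⟧ B := IsIntegralClosure.finite k⟦X⟧ k⸨X⸩ E B
  have : IsFractionRing B E :=
    IsIntegralClosure.isFractionRing_of_finite_extension k⟦X⟧ k⸨X⸩ E B
  have : FaithfulSMul k⟦X⟧ E := .trans k⟦X⟧ k⸨X⸩ E
  have : FaithfulSMul k⟦X⟧ B := .tower_bot k⟦X⟧ B E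
  have hrank : Module.finrank k⸨X⸩ E = Module.finrank k⟦X⟧ B :=
    IsFractionRing.finrank_eq k⟦X⟧ k⸨X⸩ B E
  rw [hrank] at hn ⊢
  obtain ⟨s, hs⟩ := PowerSeries.exists_pow_finrank_eq_X (B := B) hn
  exact ⟨s, congrArg (algebraMap B E) hs⟩

theorem irreducible_X_pow_sub_C_X {n : ℕ} (hn : n ≠ 0) :
    Irreducible (Polynomial.X ^ n - Polynomial.C ((PowerSeries.X : k⟦X⟧) : k⸨X⸩)) := by
  have hmon : (Polynomial.X ^ n - Polynomial.C (PowerSeries.X : k⟦X⟧)).Monic :=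
    monic_X_pow_sub_C _ hn
  have hp : (Ideal.span {(PowerSeries.X : k⟦X⟧)}).IsPrime :=
    (Ideal.span_singleton_prime PowerSeries.X_ne_zero).mpr X_prime
  have heis : (Polynomial.X ^ n - Polynomial.C (PowerSeries.X : k⟦X⟧)).IsEisensteinAt
      (Ideal.span {PowerSeries.X}) := by
    refine ⟨?_, fun {i} hi ↦ ?_, ?_⟩
    · rw [hmon.leadingCoeff]
      exact (Ideal.ne_top_iff_one _).mp hp.ne_top
    · rw [natDegree_X_pow_sub_C] at hi
      rw [coeff_sub, Polynomial.coeff_X_pow, if_neg hi.ne, zero_sub, neg_mem_iff, Polynomial.coeff_C]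
      split_ifs
      exacts [Ideal.mem_span_singleton_self _, zero_mem _]
    · rw [coeff_sub, Polynomial.coeff_X_pow, if_neg hn.symm, zero_sub, neg_mem_iff,
        Polynomial.coeff_C_zero, Ideal.span_singleton_pow, Ideal.mem_span_singleton]
      intro h
      have := X_pow_dvd_iff.mp h 1 one_lt_two
      simp at this
  have hirr := heis.irreducible hp hmon.isPrimitive (by
    rw [natDegree_X_pow_sub_C]; exact Nat.pos_of_ne_zero hn)
  rw [hmon.irreducible_iff_irreducible_map_fraction_map (K := k⸨X⸩)] at hirr
  simpa using hirr

theorem adjoin_eq_top_of_pow_finrank_eq_X [FiniteDimensional k⸨X⸩ E] {s : E}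
    (hs : s ^ Module.finrank k⸨X⸩ E = algebraMap k⸨X⸩ E ((PowerSeries.X : k⟦X⟧) : k⸨X⸩)) :
    k⸨X⸩⟮s⟯ = ⊤ := by
  have hn : Module.finrank k⸨X⸩ E ≠ 0 := Module.finrank_pos.ne'
  have hmin := minpoly.eq_of_irreducible_of_monic (irreducible_X_pow_sub_C_X (k := k) hn)
    (x := s) (by simp [hs]) (monic_X_pow_sub_C _ hn)
  refine IntermediateField.eq_of_le_of_finrank_eq le_top ?_
  rw [adjoin.finrank (Algebra.IsIntegral.isIntegral s), ← hmin, natDegree_X_pow_sub_C,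
    IntermediateField.finrank_top']

theorem primitiveRoots_nonempty [IsAlgClosed k] {n : ℕ} (hn : (n : k) ≠ 0) :
    (primitiveRoots n k⸨X⸩).Nonempty := by
  have : NeZero (n : k) := ⟨hn⟩
  have hn0 : 0 < n := Nat.pos_of_ne_zero (by rintro rfl; simp at hn)
  obtain ⟨ζ, hζ⟩ := HasEnoughRootsOfUnity.exists_primitiveRoot k n
  exact ⟨HahnSeries.C ζ, (mem_primitiveRoots hn0).mpr
    (hζ.map_of_injective (HahnSeries.C : k →+* k⸨X⸩).injective)⟩

/-- Kummer theory: a field extension of `k⸨X⸩` of degree `n` containing an `n`-th root of the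
uniformizer is cyclic. -/
theorem isGalois_and_isCyclic_of_pow_finrank_eq_X [IsAlgClosed k] [FiniteDimensional k⸨X⸩ E]
    (hn : (Module.finrank k⸨X⸩ E : k) ≠ 0) {s : E}
    (hs : s ^ Module.finrank k⸨X⸩ E = algebraMap k⸨X⸩ E ((PowerSeries.X : k⟦X⟧) : k⸨X⸩)) :
    IsGalois k⸨X⸩ E ∧ IsCyclic Gal(E/k⸨X⸩) := by
  have hroot : ∃ α : E, α ^ Module.finrank k⸨X⸩ E ∈ Set.range (algebraMap k⸨X⸩ E) ∧
      k⸨X⸩⟮α⟯ = ⊤ :=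
    ⟨s, ⟨_, hs.symm⟩, adjoin_eq_top_of_pow_finrank_eq_X hs⟩
  exact ((isCyclic_tfae k⸨X⸩ E (primitiveRoots_nonempty hn)).out 0 2).mpr hroot

end LaurentSeries

namespace AdjoinRoot

variable {K : Type*} [Field K] {g : Polynomial K} [Fact (Irreducible g)]

theorem isSeparable_of_separable (hg : g.Separable) : Algebra.IsSeparable K (AdjoinRoot g) := by
  have := IsGalois.of_separable_splitting_field (E := g.SplittingField) hg
  obtain ⟨α, hα⟩ := (Polynomial.SplittingField.splits g).exists_eval_eq_zero
    (by rw [Polynomial.degree_map]; exact (Fact.out : Irreducible g).degree_pos.ne')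
  rw [Polynomial.eval_map] at hα
  exact .of_algHom K g.SplittingField (liftAlgHom g (Algebra.ofId K g.SplittingField) α hα)

theorem isSplittingField_of_normal [Normal K (AdjoinRoot g)] :
    Polynomial.IsSplittingField K (AdjoinRoot g) g where
  splits' := by
    have hg : g ≠ 0 := (Fact.out : Irreducible g).ne_zero
    have h := Normal.splits ‹_› (root g)
    rw [minpoly_root hg] at h
    refine h.of_dvd ?_ (Polynomial.map_dvd _ (dvd_mul_right _ _))
    simpa using hg
  adjoin_rootSet' := by
    rw [eq_top_iff, ← adjoinRoot_eq_top]
    refine Algebra.adjoin_mono (Set.singleton_subset_iff.mpr ?_)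
    rw [Polynomial.mem_rootSet]
    exact ⟨(Fact.out : Irreducible g).ne_zero, by simp⟩

end AdjoinRoot

theorem Irreducible.separable_of_natDegree_ne_zero {K : Type*} [Field K] {g : Polynomial K}
    (hg : Irreducible g) (hdeg : (g.natDegree : K) ≠ 0) : g.Separable := by
  rw [Polynomial.separable_iff_derivative_ne_zero hg]
  intro h
  have hn : g.natDegree ≠ 0 := by rintro h; simp [h] at hdeg
  have hcoeff := congrArg (Polynomial.coeff · (g.natDegree - 1)) h
  simp only [Polynomial.coeff_derivative, Polynomial.coeff_zero, Nat.cast_pred hn.bot_lt,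
    sub_add_cancel] at hcoeff
  rw [Nat.sub_add_cancel (Nat.pos_of_ne_zero hn)] at hcoeff
  exact mul_ne_zero (Polynomial.leadingCoeff_ne_zero.mpr hg.ne_zero) hdeg hcoeff

/-- Over `K = k((t))` with `k` algebraically closed and `char k = 0` or
`char k > n`, the splitting field `L` of an irreducible polynomial `g` of degree `n ≥ 1`
satisfies `[L : K] = n`, `L/K` is Galois with cyclic Galois group, and `L = K(s)` for some
`s` with `s^n = t`. -/
theorem stmt_9 {k : Type*} [Field k] [IsAlgClosed k] (n : ℕ) (hn : 1 ≤ n)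
    (hchar : ringChar k = 0 ∨ n < ringChar k)
    (g : Polynomial (LaurentSeries k)) (hirr : Irreducible g) (hdeg : g.natDegree = n) :
    Module.finrank (LaurentSeries k) g.SplittingField = n ∧
      IsGalois (LaurentSeries k) g.SplittingField ∧
      IsCyclic (g.SplittingField ≃ₐ[LaurentSeries k] g.SplittingField) ∧
      ∃ s : g.SplittingField,
        s ^ n = algebraMap (LaurentSeries k) g.SplittingField
            ((PowerSeries.X : PowerSeries k) : LaurentSeries k) ∧
        IntermediateField.adjoin (LaurentSeries k) {s} = ⊤ := by
  have hnk : (n : k) ≠ 0 := by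
    rw [Ne, ringChar.spec]
    rcases hchar with h | h
    · rw [h, zero_dvd_iff]; lia
    · exact Nat.not_dvd_of_pos_of_lt hn h
  have : Fact (Irreducible g) := ⟨hirr⟩
  let E := AdjoinRoot g
  have hE : Module.finrank (LaurentSeries k) E = n := by
    rw [(AdjoinRoot.powerBasis hirr.ne_zero).finrank, AdjoinRoot.powerBasis_dim, hdeg]
  have hfin : FiniteDimensional (LaurentSeries k) E := .of_finrank_pos (by lia)
  have hsep : Algebra.IsSeparable (LaurentSeries k) E := by
    refine AdjoinRoot.isSeparable_of_separable (hirr.separable_of_natDegree_ne_zero ?_)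
    rw [hdeg, ← map_natCast (HahnSeries.C : k →+* LaurentSeries k), map_ne_zero]
    exact hnk
  subst hE
  obtain ⟨s, hs⟩ := LaurentSeries.exists_pow_finrank_eq_X (E := E) hnk
  have hgal := (LaurentSeries.isGalois_and_isCyclic_of_pow_finrank_eq_X hnk hs).1
  have : Polynomial.IsSplittingField (LaurentSeries k) E g :=
    AdjoinRoot.isSplittingField_of_normal
  let e : E ≃ₐ[LaurentSeries k] g.SplittingField := Polynomial.IsSplittingField.algEquiv E g
  have hes : e s ^ Module.finrank (LaurentSeries k) E = algebraMap (LaurentSeries k)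
      g.SplittingField ((PowerSeries.X : PowerSeries k) : LaurentSeries k) := by
    rw [← map_pow, hs, e.commutes]
  have hrank := e.toLinearEquiv.finrank_eq
  rw [hrank] at hnk hes ⊢
  obtain ⟨hgal', hcyc⟩ := LaurentSeries.isGalois_and_isCyclic_of_pow_finrank_eq_X hnk hes
  exact ⟨rfl, hgal', hcyc, e s, hes, LaurentSeries.adjoin_eq_top_of_pow_finrank_eq_X hes⟩
end
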